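/- Let B be a unital C*-algebra, n a positive integer, and let v = (v_1, …, v_n) and b = (b_1, …, b_n) be tuples of elements of B, regarded as row matrices in M_{1,n}(B). Assume v is a row isometry (v* v = 1_n) and b is a strict row contraction (‖b b*‖ < 1). Define w := (1 − b b*)^{1/2} (1 − v b*)^{-1} (b − v) (1_n − b* b)^{-1/2} ∈ M_{1,n}(B). Then 1 − w b* is invertible in B and applying the same transform to w recovers v: (1 − b b*)^{1/2} (1 − w b*)^{-1} (b − w) (1_n − b* b)^{-1/2} = v. In other words, the Möbius-type transform v ↦ w determined by b is an involution on row isometries. -/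

import Mathlib

/- STATEMENT 3: the Möbius-type transform determined by a strict row contraction `b`
is an involution on row isometries: applying it twice to a row isometry `v`
recovers `v`. -/

noncomputable section

/-- `x y* = ∑ i, x i * (y i)*`. -/
def rowMulStar {B : Type*} [NonUnitalNonAssocSemiring B] [StarRing B] {n : ℕ}
    (x y : Fin n → B) : B :=
  ∑ i, x i * star (y i)

/-- `b* b = [bᵢ* bⱼ] ∈ Mₙ(B)`. -/
def gramMatrix {B : Type*} [NonUnitalNonAssocSemiring B] [StarRing B] {n : ℕ}
    (b : Fin n → B) : Matrix (Fin n) (Fin n) B :=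
  Matrix.of fun i j => star (b i) * b j

/-- Positivity in a C*-algebra: `x` is positive iff it is of the form `c* c`. -/
def IsPositive {B : Type*} [Mul B] [Star B] (x : B) : Prop := ∃ c, x = star c * c

/-- The Möbius-type transform
`w = (1 - b b*)^{1/2} (1 - v b*)⁻¹ (b - v) (1ₙ - b* b)^{-1/2}`,
where `s` is the positive square root `(1 - b b*)^{1/2}` and `t` is the positive square
root `(1ₙ - b* b)^{1/2}`. -/
def mobius {B : Type*} [Ring B] [StarRing B] {n : ℕ}
    (s : B) (t : Matrix (Fin n) (Fin n) B) (b v : Fin n → B) : Fin n → B :=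
  fun j => ∑ i, (s * Ring.inverse (1 - rowMulStar v b) * (b i - v i)) * Ring.inverse t i j

open Matrix

/-- An element commuting with the square of `star c * c` commutes with `star c * c`. -/
theorem IsPositive.commute_of_mul_self {A : Type*} [CStarAlgebra A] {a x : A}
    (ha : IsPositive a) (h : Commute (a * a) x) : Commute a x := by
  let _ := CStarAlgebra.spectralOrder A
  have := CStarAlgebra.spectralOrderedRing A
  obtain ⟨c, rfl⟩ := ha
  have := h.cfcₙ_nnreal NNReal.sqrt
  rwa [← CFC.sqrt, CFC.sqrt_mul_self _ (star_mul_self_nonneg c)] at this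

theorem IsPositive.star_eq {A : Type*} [Mul A] [StarMul A] {a : A}
    (ha : IsPositive a) : star a = a := by
  obtain ⟨c, rfl⟩ := ha
  simp

/-- Positive elements intertwine whatever their squares intertwine. -/
theorem IsPositive.smul_eq_vecMul {B : Type*} [CStarAlgebra B] {n : ℕ} {s : B}
    {t : Matrix (Fin n) (Fin n) B} (hs : IsPositive s) (ht : IsPositive t) {b : Fin n → B}
    (h : (s * s) • b = b ᵥ* (t * t)) : s • b = b ᵥ* t := by
  let _ := CStarAlgebra.spectralOrder B
  have := CStarAlgebra.spectralOrderedRing B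
  obtain ⟨c, rfl⟩ := hs
  obtain ⟨d, rfl⟩ := ht
  set s := star c * c
  set t := star d * d
  let diag (x : B) (y : Matrix (Fin n) (Fin n) B) : Matrix (Unit ⊕ Fin n) (Unit ⊕ Fin n) B :=
    fromBlocks (of fun _ _ => x) 0 0 y
  let N : Matrix (Unit ⊕ Fin n) (Unit ⊕ Fin n) B := fromBlocks 0 (of fun _ => b) 0 0
  have key (x : B) (y : Matrix (Fin n) (Fin n) B) :
      diag x y * N = N * diag x y ↔ x • b = b ᵥ* y := by
    simp only [diag, N, fromBlocks_multiply, ← Matrix.ext_iff, funext_iff]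
    simp [Matrix.mul_apply, vecMul, dotProduct]
  have hmul (x x' : B) (y y' : Matrix (Fin n) (Fin n) B) :
      diag x y * diag x' y' = diag (x * x') (y * y') := by
    simp only [diag, fromBlocks_multiply]
    congr 1 <;> ext <;> simp [Matrix.mul_apply]
  have hstar : star (diag c d) = diag (star c) (star d) := by
    simp only [diag, star_eq_conjTranspose, fromBlocks_conjTranspose]
    congr 1 <;> ext <;> simp
  have hpos : IsPositive (B := CStarMatrix (Unit ⊕ Fin n) (Unit ⊕ Fin n) B) (diag s t) := by
    refine ⟨diag c d, ?_⟩
    change diag s t = star (diag c d) * diag c d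
    rw [hstar, hmul]
  refine (key s t).1 (IsPositive.commute_of_mul_self
    (A := CStarMatrix (Unit ⊕ Fin n) (Unit ⊕ Fin n) B) (x := N) hpos ?_)
  change diag s t * diag s t * N = N * (diag s t * diag s t)
  rwa [hmul, key]

theorem rowMulStar_eq_dotProduct {B : Type*} [NonUnitalNonAssocSemiring B] [StarRing B] {n : ℕ}
    (x y : Fin n → B) : rowMulStar x y = x ⬝ᵥ star y := rfl

theorem gramMatrix_eq_vecMulVec {B : Type*} [NonUnitalNonAssocSemiring B] [StarRing B] {n : ℕ}
    (b : Fin n → B) : gramMatrix b = vecMulVec (star b) b := rfl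

theorem mobius_eq_vecMul {B : Type*} [Ring B] [StarRing B] {n : ℕ}
    (s : B) (t : Matrix (Fin n) (Fin n) B) (b v : Fin n → B) :
    mobius s t b v =
      ((s * Ring.inverse (1 - rowMulStar v b)) • (b - v)) ᵥ* Ring.inverse t := rfl

theorem isUnit_one_sub_vecMulVec {R ι : Type*} [Ring R] [Fintype ι] [DecidableEq ι]
    {u b : ι → R} (h : IsUnit (1 - b ⬝ᵥ u)) : IsUnit (1 - vecMulVec u b) := by
  obtain ⟨k, hk, hk'⟩ := isUnit_iff_exists.1 h
  rw [isUnit_iff_exists]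
  refine ⟨1 + vecMulVec u (k • b), ?_, ?_⟩
  · have e : k • b - (b ⬝ᵥ u) • k • b = b := by
      rw [smul_smul, ← sub_smul, ← one_sub_mul, hk, one_smul]
    rw [mul_add, mul_one, sub_mul, one_mul, vecMulVec_mul_vecMulVec, ← vecMulVec_sub, e]
    abel
  · have e : k • b - (k * (b ⬝ᵥ u)) • b = b := by
      rw [← sub_smul, ← mul_one_sub, hk', one_smul]
    rw [add_mul, one_mul, mul_sub, mul_one, vecMulVec_mul_vecMulVec, smul_dotProduct,
      smul_eq_mul, ← vecMulVec_sub, e]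
    abel

theorem isUnit_of_isUnit_mul_self {M : Type*} [Monoid M] {a : M} (h : IsUnit (a * a)) :
    IsUnit a :=
  ((Commute.refl a).isUnit_mul_iff.1 h).1

theorem star_rowMulStar {B : Type*} [NonUnitalSemiring B] [StarRing B] {n : ℕ}
    (x y : Fin n → B) : star (rowMulStar x y) = rowMulStar y x := by
  simp [rowMulStar]

/-- If `v* v = 1`, then `(v b*)* (v b*) = b b*`. -/
theorem rowMulStar_mul_rowMulStar {B : Type*} [Ring B] [StarRing B] {n : ℕ} {v : Fin n → B}
    (hv : ∀ i j, star (v i) * v j = if i = j then (1 : B) else 0) (b : Fin n → B) :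
    rowMulStar b v * rowMulStar v b = rowMulStar b b := by
  have (i j : Fin n) : b i * star (v i) * (v j * star (b j)) =
      if i = j then b i * star (b j) else 0 := by
    rw [mul_assoc, ← mul_assoc (star (v i)), hv]
    split_ifs <;> simp
  simp [rowMulStar, Finset.sum_mul_sum, this]

theorem norm_rowMulStar_lt_one {B : Type*} [CStarAlgebra B] {n : ℕ} {v b : Fin n → B}
    (hv : ∀ i j, star (v i) * v j = if i = j then (1 : B) else 0)
    (hb : ‖rowMulStar b b‖ < 1) : ‖rowMulStar v b‖ < 1 := by
  rw [← rowMulStar_mul_rowMulStar hv, ← star_rowMulStar v b, CStarRing.norm_star_mul_self] at hb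
  nlinarith [norm_nonneg (rowMulStar v b)]

theorem mobius_involutive {B : Type*} [CStarAlgebra B]
    {n : ℕ} (hn : 0 < n) (v b : Fin n → B)
    (hv : ∀ i j, star (v i) * v j = if i = j then (1 : B) else 0)
    (hb : ‖rowMulStar b b‖ < 1)
    (s : B) (hs_pos : IsPositive s) (hs_sq : s * s = 1 - rowMulStar b b)
    (t : Matrix (Fin n) (Fin n) B) (ht_pos : IsPositive t)
    (ht_sq : t * t = 1 - gramMatrix b) :
    IsUnit (1 - rowMulStar (mobius s t b v) b) ∧
    mobius s t b (mobius s t b v) = v := by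
  have hD : IsUnit (1 - rowMulStar v b) :=
    isUnit_one_sub_of_norm_lt_one (norm_rowMulStar_lt_one hv hb)
  have hr : IsUnit (1 - rowMulStar b b) := isUnit_one_sub_of_norm_lt_one hb
  have hs : IsUnit s := isUnit_of_isUnit_mul_self (hs_sq ▸ hr)
  have ht : IsUnit t := isUnit_of_isUnit_mul_self (ht_sq ▸ isUnit_one_sub_vecMulVec hr)
  have hsb : s • b = b ᵥ* t := by
    refine hs_pos.smul_eq_vecMul ht_pos ?_
    rw [hs_sq, ht_sq, sub_smul, one_smul, vecMul_sub, vecMul_one, gramMatrix_eq_vecMulVec,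
      vecMul_vecMulVec, rowMulStar_eq_dotProduct]
  have htb : t *ᵥ star b = MulOpposite.op s • star b := by
    have := congrArg star hsb
    rw [star_vecMul, ← star_eq_conjTranspose, ht_pos.star_eq] at this
    rw [← this]
    ext i
    simp [hs_pos.star_eq]
  obtain ⟨D, hD'⟩ := hD
  obtain ⟨S, rfl⟩ := hs
  obtain ⟨T, rfl⟩ := ht
  have htb' : (↑T⁻¹ : Matrix (Fin n) (Fin n) B) *ᵥ star b =
      MulOpposite.op (↑S⁻¹ : B) • star b := by
    have e : star b = MulOpposite.op (↑S⁻¹ : B) • (T : Matrix (Fin n) (Fin n) B) *ᵥ star b := by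
      rw [htb, smul_smul, ← MulOpposite.op_mul, S.mul_inv, MulOpposite.op_one, one_smul]
    conv_lhs => rw [e]
    rw [mulVec_smul, mulVec_mulVec, T.inv_mul, one_mulVec]
  have hw : mobius (S : B) (T : Matrix (Fin n) (Fin n) B) b v =
      ((S * ↑D⁻¹ : B) • (b - v)) ᵥ* (↑T⁻¹ : Matrix (Fin n) (Fin n) B) := by
    rw [mobius_eq_vecMul, ← hD', Ring.inverse_unit, Ring.inverse_unit]
  have hE : 1 - rowMulStar (mobius (S : B) (T : Matrix (Fin n) (Fin n) B) b v) b =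
      ↑(S * D⁻¹ * S) := by
    have e : rowMulStar (b - v) b = D - S * S := by
      rw [hD', hs_sq]
      simp [rowMulStar_eq_dotProduct, sub_dotProduct]
    rw [hw, rowMulStar_eq_dotProduct, ← dotProduct_mulVec, htb', dotProduct_smul,
      smul_dotProduct, ← rowMulStar_eq_dotProduct, e]
    simp [mul_sub, sub_mul, mul_assoc]
  refine ⟨hE ▸ Units.isUnit _, ?_⟩
  have he : b ᵥ* (↑T⁻¹ : Matrix (Fin n) (Fin n) B) = (↑S⁻¹ : B) • b := by
    have := congrArg (fun x => (↑S⁻¹ : B) • x ᵥ* (↑T⁻¹ : Matrix (Fin n) (Fin n) B)) hsb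
    simpa [smul_vecMul, smul_smul, vecMul_vecMul] using this
  have hb' : (↑S⁻¹ * ↑S⁻¹ : B) • b =
      b ᵥ* ((↑T⁻¹ : Matrix (Fin n) (Fin n) B) * (↑T⁻¹ : Matrix (Fin n) (Fin n) B)) := by
    rw [← vecMul_vecMul, he, smul_vecMul, he, smul_smul]
  have hDb : (D : B) • b - (b - v) = v ᵥ* ((T : Matrix (Fin n) (Fin n) B) * (T : Matrix (Fin n) (Fin n) B)) := by
    rw [ht_sq, hD', vecMul_sub, vecMul_one, gramMatrix_eq_vecMulVec, vecMul_vecMulVec,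
      rowMulStar_eq_dotProduct, sub_smul, one_smul]
    abel
  have hDS : (S : B) * ↑(S * D⁻¹ * S)⁻¹ = D * ↑S⁻¹ := by
    simp [← mul_assoc]
  rw [mobius_eq_vecMul, hE, Ring.inverse_unit, Ring.inverse_unit, hDS, hw, smul_vecMul,
    sub_vecMul, smul_vecMul, smul_vecMul, vecMul_vecMul, he, smul_sub, smul_smul, mul_assoc,
    ← smul_smul, hb', smul_smul, ← mul_assoc, mul_assoc (D : B), S.inv_mul, mul_one, D.mul_inv,
    one_smul, ← smul_vecMul, ← sub_vecMul, hDb, vecMul_vecMul]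
  simp [mul_assoc]
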